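/- arXiv:1004.5195 — 3 statements merged into one kernel-verified Lean document; each statement's English description precedes it below -/
import Mathlib

section
/- Let w ≥ 2 be an integer. If there exists a 2-perfect code in the Johnson graph J(2w,w), then there exists a nonnegative integer y with y² = 2w² - 6w + 5; equivalently, (2w-3)² - 2y² = -1. -/
/-- The Johnson distance between two subsets `A` and `B` of `Fin n`
(for `w`-subsets this is `w - |A ∩ B|`). -/
def johnsonDist {n : ℕ} (A B : Finset (Fin n)) : ℕ := A.card - (A ∩ B).card

/-- `C` is an `e`-perfect code in the Johnson graph `J(n,w)`:
all codewords are `w`-subsets of `{1,…,n}`, and every `w`-subset `v` of `{1,…,n}`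
is within Johnson distance `e` of exactly one codeword. -/
def IsPerfectCode (n w e : ℕ) (C : Finset (Finset (Fin n))) : Prop :=
  (∀ c ∈ C, c.card = w) ∧
  ∀ v : Finset (Fin n), v.card = w → ∃! c, c ∈ C ∧ johnsonDist v c ≤ e

/-- `C` is a `t`-design with index `lam`: every `t`-subset of `{1,…,n}` is
contained in exactly `lam` codewords of `C`. -/
def IsDesign (n t lam : ℕ) (C : Finset (Finset (Fin n))) : Prop :=
  ∀ T : Finset (Fin n), T.card = t → (C.filter (fun c => T ⊆ c)).card = lam

/-- The strength of `C` is the largest `t` for which `C` is a `t`-design. -/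
def HasStrength (n : ℕ) (C : Finset (Finset (Fin n))) (φ : ℕ) : Prop :=
  (∃ lam, 0 < lam ∧ IsDesign n φ lam C) ∧
  ∀ t, φ < t → ¬ ∃ lam, 0 < lam ∧ IsDesign n t lam C

namespace JohnsonCode

open Finset

variable {α : Type*} [Fintype α] [DecidableEq α]

/-- The value at `v` is the sum of `f` over the sets obtained by adding a point to `v`. -/
def up : Module.End ℤ (Finset α → ℤ) where
  toFun f v := ∑ y ∈ vᶜ, f (insert y v)
  map_add' f g := by ext v; simp [sum_add_distrib]
  map_smul' r f := by ext v; simp [mul_sum]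

/-- The value at `v` is the sum of `f` over the sets obtained by removing a point from `v`. -/
def down : Module.End ℤ (Finset α → ℤ) where
  toFun f v := ∑ x ∈ v, f (v.erase x)
  map_add' f g := by ext v; simp [sum_add_distrib]
  map_smul' r f := by ext v; simp [mul_sum]

theorem up_apply (f : Finset α → ℤ) (v : Finset α) :
    up f v = ∑ y ∈ vᶜ, f (insert y v) := rfl

omit [Fintype α] in
theorem down_apply (f : Finset α → ℤ) (v : Finset α) :
    down f v = ∑ x ∈ v, f (v.erase x) := rfl

theorem up_down_apply (f : Finset α → ℤ) (v : Finset α) :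
    up (down f) v = down (up f) v + ((Fintype.card α : ℤ) - 2 * #v) * f v := by
  have h₁ : up (down f) v
      = #vᶜ * f v + ∑ y ∈ vᶜ, ∑ x ∈ v, f ((insert y v).erase x) := by
    simp only [up_apply, down_apply]
    rw [← nsmul_eq_mul, ← sum_const, ← sum_add_distrib]
    refine sum_congr rfl fun y hy => ?_
    rw [mem_compl] at hy
    rw [sum_insert hy, erase_insert hy]
  have h₂ : down (up f) v
      = #v * f v + ∑ x ∈ v, ∑ y ∈ vᶜ, f ((insert y v).erase x) := by
    simp only [up_apply, down_apply]
    rw [← nsmul_eq_mul, ← sum_const, ← sum_add_distrib]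
    refine sum_congr rfl fun x hx => ?_
    rw [compl_erase, sum_insert (by simpa using hx), insert_erase hx]
    congr 1
    refine sum_congr rfl fun y hy => ?_
    rw [erase_insert_of_ne]
    rintro rfl
    exact (mem_compl.1 hy) hx
  have hc : (#vᶜ : ℤ) = Fintype.card α - #v := by
    rw [card_compl, Nat.cast_sub (card_le_univ v)]
  rw [h₁, h₂, sum_comm, hc]
  ring

theorem up_pow_succ_apply (k : ℕ) (f : Finset α → ℤ) (v : Finset α) :
    (up ^ (k + 1)) f v = ∑ y ∈ vᶜ, (up ^ k) f (insert y v) := by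
  rw [pow_succ', Module.End.mul_apply, up_apply]

theorem up_pow_down_apply (k : ℕ) (f : Finset α → ℤ) (v : Finset α) :
    (up ^ k) (down f) v = down ((up ^ k) f) v
      + k * ((Fintype.card α : ℤ) - 2 * #v - k + 1) * (up ^ (k - 1)) f v := by
  induction k generalizing v with
  | zero => simp
  | succ k ih =>
    rw [up_pow_succ_apply]
    have h : ∀ y ∈ vᶜ, (up ^ k) (down f) (insert y v) = down ((up ^ k) f) (insert y v)
        + k * ((Fintype.card α : ℤ) - 2 * #v - k - 1) * (up ^ (k - 1)) f (insert y v) := by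
      intro y hy
      rw [ih, card_insert_of_notMem (mem_compl.1 hy)]
      push_cast
      ring
    rw [sum_congr rfl h, sum_add_distrib, ← mul_sum, ← up_apply, up_down_apply,
      ← Module.End.mul_apply up, ← pow_succ']
    rcases k with _ | k
    · simp
    · rw [Nat.add_sub_cancel, Nat.add_sub_cancel, ← up_pow_succ_apply]
      push_cast
      ring

/-- The function whose value at `v` depends only on `#(v \ c)` and `#(v ∩ c)`. -/
def lift (c : Finset α) (h : ℕ → ℕ → ℤ) : Finset α → ℤ := fun v => h #(v \ c) #(v ∩ c)

omit [Fintype α] in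
theorem down_lift (c : Finset α) (h : ℕ → ℕ → ℤ) :
    down (lift c h) = lift c fun a b => a * h (a - 1) b + b * h a (b - 1) := by
  ext v
  have h₁ : ∀ x ∈ v \ c, lift c h (v.erase x) = h (#(v \ c) - 1) #(v ∩ c) := by
    intro x hx
    have hxc := (mem_sdiff.1 hx).2
    rw [lift, erase_sdiff_comm, card_erase_of_mem hx, erase_inter,
      erase_eq_of_notMem (by simp [hxc])]
  have h₂ : ∀ x ∈ v ∩ c, lift c h (v.erase x) = h #(v \ c) (#(v ∩ c) - 1) := by
    intro x hx
    have hxc := (mem_inter.1 hx).2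
    rw [lift, erase_sdiff_comm, erase_inter, card_erase_of_mem hx,
      erase_eq_of_notMem (by simp [hxc])]
  rw [down_apply, ← sum_inter_add_sum_sdiff v c, sum_congr rfl h₁, sum_congr rfl h₂, add_comm]
  simp [lift]

theorem up_lift (c : Finset α) (h : ℕ → ℕ → ℤ) :
    up (lift c h) = lift c fun a b =>
      ((Fintype.card α : ℤ) - #c - a) * h (a + 1) b + ((#c : ℤ) - b) * h a (b + 1) := by
  ext v
  have h₁ : ∀ x ∈ vᶜ \ c, lift c h (insert x v) = h (#(v \ c) + 1) #(v ∩ c) := by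
    intro x hx
    simp only [mem_sdiff, mem_compl] at hx
    rw [lift, insert_sdiff_of_notMem _ hx.2, insert_inter_of_notMem hx.2,
      card_insert_of_notMem (by simp [hx.1])]
  have h₂ : ∀ x ∈ vᶜ ∩ c, lift c h (insert x v) = h #(v \ c) (#(v ∩ c) + 1) := by
    intro x hx
    simp only [mem_inter, mem_compl] at hx
    rw [lift, insert_sdiff_of_mem _ hx.2, insert_inter_of_mem hx.2,
      card_insert_of_notMem (by simp [hx.1])]
  have e₁ : #(vᶜ ∩ c) + #(v ∩ c) = #c := by
    rw [inter_comm, inter_comm v, ← sdiff_eq_inter_compl, card_sdiff_add_card_inter]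
  have e₂ := card_sdiff_add_card_inter vᶜ c
  have e₃ := card_sdiff_add_card_inter v c
  have e₄ := card_add_card_compl v
  rw [up_apply, ← sum_inter_add_sum_sdiff vᶜ c, sum_congr rfl h₁, sum_congr rfl h₂, add_comm,
    sum_const, sum_const, nsmul_eq_mul, nsmul_eq_mul, lift]
  congr 2 <;> omega

/-- Four times the adjacency operator of the relation of being at Johnson distance at most `2`,
on functions on `w`-sets. -/
def ballOp (w : ℕ) : Module.End ℤ (Finset α → ℤ) :=
  down * down * up * up + (8 - 4 * w : ℤ) • (down * up) + (2 * w ^ 2 - 6 * w + 4 : ℤ) • 1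

theorem ballOp_apply (w : ℕ) (f : Finset α → ℤ) :
    ballOp w f = down (down (up (up f))) + (8 - 4 * w : ℤ) • down (up f)
      + (2 * w ^ 2 - 6 * w + 4 : ℤ) • f := rfl

theorem ballOp_indicator {w : ℕ} {v c : Finset α} (hv : #v = w) (hc : #c = w) :
    ballOp w (fun u => if u = c then 1 else 0) v = if w - #(v ∩ c) ≤ 2 then 4 else 0 := by
  have h : (fun u => if u = c then 1 else 0 : Finset α → ℤ)
      = lift c fun a b => if a = 0 ∧ b = w then 1 else 0 := by
    ext u
    have : u = c ↔ #(u \ c) = 0 ∧ #(u ∩ c) = w := by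
      rw [card_eq_zero, sdiff_eq_empty_iff_subset]
      constructor
      · rintro rfl
        simpa using hc
      · rintro ⟨hu, h⟩
        rw [inter_eq_left.2 hu] at h
        exact eq_of_subset_of_card_le hu (by omega)
    simp [lift, this]
  rw [h, ballOp_apply]
  simp only [up_lift, down_lift, Pi.add_apply, Pi.smul_apply, lift, hc]
  have hab := card_sdiff_add_card_inter v c
  rw [hv] at hab
  generalize #(v \ c) = a at *
  generalize #(v ∩ c) = b at *
  subst hab
  rcases a with _ | _ | _ | a
  · rcases b with _ | _ | b <;> simp <;> ring
  · rcases b with _ | _ | b <;> simp [add_comm 1] <;> ring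
  · rcases b with _ | _ | b <;> simp [add_comm 2]
  · simp

theorem ballOp_one {w : ℕ} (hα : Fintype.card α = 2 * w) {v : Finset α} (hv : #v = w) :
    ballOp w 1 v = w ^ 4 - 2 * w ^ 3 + 5 * w ^ 2 + 4 := by
  have h : (1 : Finset α → ℤ) = lift ∅ fun _ _ => 1 := rfl
  rw [h, ballOp_apply]
  simp only [up_lift, down_lift, Pi.add_apply, Pi.smul_apply, lift, hα]
  rcases w with _ | _ | w
  · simp [hv]
  · simp [hv]
  · simp [hv]
    ring

theorem up_pow_ballOp {w k : ℕ} (hα : Fintype.card α = 2 * w) {f : Finset α → ℤ}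
    (hf : ∀ u : Finset α, #u + (k + 1) = w → (up ^ (k + 1)) f u = 0)
    {v : Finset α} (hv : #v + k = w) :
    (up ^ k) (ballOp w f) v = (((k : ℤ) * (k + 1)) ^ 2 + (6 - 4 * w) * (k * (k + 1))
      + (2 * w ^ 2 - 6 * w + 4)) * (up ^ k) f v := by
  have hf' : ∀ u : Finset α, #u + (k + 2) = w → (up ^ (k + 2)) f u = 0 := by
    intro u hu
    rw [up_pow_succ_apply]
    refine sum_eq_zero fun y hy => hf _ ?_
    rw [card_insert_of_notMem (mem_compl.1 hy)]
    omega
  have up_comp : ∀ (i : ℕ) (g : Finset α → ℤ), (up ^ i) (up g) = (up ^ (i + 1)) g :=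
    fun i g => by rw [pow_succ, Module.End.mul_apply]
  have down_zero : ∀ (g : Finset α → ℤ) (u : Finset α) (j : ℕ),
      #u + j = w → (∀ t : Finset α, #t + (j + 1) = w → g t = 0) → down g u = 0 := by
    intro g u j hu hg
    refine sum_eq_zero fun x hx => hg _ ?_
    rw [← hu, ← card_erase_add_one hx]
    ring
  have hvw : (#v : ℤ) = w - k := by omega
  have h₁ : (up ^ k) (down (up f)) v = k * (k + 1) * (up ^ k) f v := by
    rw [up_pow_down_apply, up_comp, up_comp, down_zero _ v k hv hf, hα, hvw]
    rcases k with _ | k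
    · simp
    · simp only [Nat.add_sub_cancel]
      push_cast
      ring
  have h₂ : (up ^ k) (down (down (up (up f)))) v
      = (k - 1) * k * (k + 1) * (k + 2) * (up ^ k) f v := by
    rw [up_pow_down_apply, down_zero _ v k hv, hα, hvw]
    · rcases k with _ | k
      · simp
      · rw [Nat.add_sub_cancel, up_pow_down_apply, up_comp, up_comp, up_comp, up_comp,
          down_zero _ v _ hv hf, hα, hvw]
        rcases k with _ | k
        · simp
        · simp only [Nat.add_sub_cancel]
          push_cast
          ring
    · intro t ht
      rw [up_pow_down_apply, up_comp, up_comp, up_comp, up_comp,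
        down_zero _ t _ ht hf']
      rcases k with _ | k
      · simp
      · rw [Nat.add_sub_cancel, hf t ht]
        simp
  rw [ballOp_apply, map_add, map_add, map_smul, map_smul, Pi.add_apply, Pi.add_apply,
    Pi.smul_apply, Pi.smul_apply, h₁, h₂, smul_eq_mul, smul_eq_mul]
  ring

theorem up_pow_eq_zero {w : ℕ} {g : Finset α → ℤ} (hg : ∀ v : Finset α, #v = w → g v = 0)
    (k : ℕ) {v : Finset α} (hv : #v + k = w) : (up ^ k) g v = 0 := by
  induction k generalizing v with
  | zero => exact hg v hv
  | succ k ih =>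
    rw [up_pow_succ_apply]
    refine sum_eq_zero fun y hy => ih ?_
    rw [card_insert_of_notMem (mem_compl.1 hy)]
    omega

theorem exists_root_of_ballOp_eq_zero {w : ℕ} (hα : Fintype.card α = 2 * w) {f : Finset α → ℤ}
    (hf : ∀ v : Finset α, #v = w → ballOp w f v = 0) {v : Finset α} (hv : #v = w)
    (hfv : f v ≠ 0) :
    ∃ k : ℕ, ((k : ℤ) * (k + 1)) ^ 2 + (6 - 4 * w) * (k * (k + 1))
      + (2 * w ^ 2 - 6 * w + 4) = 0 := by
  by_contra! hroot
  have key : ∀ j k : ℕ, k + j = w + 1 →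
      ∀ u : Finset α, #u + k = w → (up ^ k) f u = 0 := by
    intro j
    induction j with
    | zero => intro k hk u hu; omega
    | succ j ih =>
      intro k hk u hu
      have h := up_pow_ballOp hα (ih (k + 1) (by omega)) hu
      rw [up_pow_eq_zero hf k hu] at h
      exact (mul_eq_zero.1 h.symm).resolve_left (hroot k)
  exact hfv (key (w + 1) 0 (by omega) v hv)

theorem ballOp_perfectCode {n w : ℕ} {C : Finset (Finset (Fin n))} (hC : IsPerfectCode n w 2 C)
    {v : Finset (Fin n)} (hv : #v = w) :
    ballOp w (∑ c ∈ C, fun u => if u = c then 1 else 0) v = 4 := by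
  obtain ⟨c₀, ⟨hc₀, hd₀⟩, huniq⟩ := hC.2 v hv
  rw [map_sum, Finset.sum_apply, sum_eq_single_of_mem c₀ hc₀, ballOp_indicator hv (hC.1 _ hc₀), if_pos]
  · simpa [johnsonDist, hv] using hd₀
  · intro c hc hne
    rw [ballOp_indicator hv (hC.1 _ hc), if_neg]
    intro h
    exact hne (huniq c ⟨hc, by simpa [johnsonDist, hv] using h⟩)

end JohnsonCode

open JohnsonCode in
/-- If a `2`-perfect code exists in `J(2w,w)`, then there is a nonnegative
integer `y` with `y² = 2w² - 6w + 5`, i.e. `(2w-3)² - 2y² = -1`. -/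
theorem two_perfect_pell (w : ℕ) (hw : 2 ≤ w)
    (hC : ∃ C : Finset (Finset (Fin (2 * w))), IsPerfectCode (2 * w) w 2 C) :
    ∃ y : ℕ, (y : ℤ) ^ 2 = 2 * (w : ℤ) ^ 2 - 6 * (w : ℤ) + 5 ∧
      (2 * (w : ℤ) - 3) ^ 2 - 2 * (y : ℤ) ^ 2 = -1 := by
  obtain ⟨C, hC⟩ := hC
  set g : Finset (Fin (2 * w)) → ℤ := ∑ c ∈ C, fun u => if u = c then 1 else 0 with hg
  have hcard : Fintype.card (Fin (2 * w)) = 2 * w := Fintype.card_fin _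
  set K : ℤ := w ^ 4 - 2 * w ^ 3 + 5 * w ^ 2 + 4 with hK
  have hK4 : 4 < K := by
    have hw' : (2 : ℤ) ≤ w := by exact_mod_cast hw
    nlinarith [sq_nonneg ((w : ℤ) * (w - 1)),
      mul_pos (by linarith : (0 : ℤ) < w) (by linarith : (0 : ℤ) < w)]
  obtain ⟨v, -, hv⟩ := Finset.exists_subset_card_eq
    (s := (Finset.univ : Finset (Fin (2 * w)))) (n := w) (by simp; omega)
  obtain ⟨k, hk⟩ := exists_root_of_ballOp_eq_zero hcard (f := K • g - (4 : ℤ) • 1)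
    (fun u hu => by
      rw [map_sub, map_smul, map_smul, Pi.sub_apply, Pi.smul_apply, Pi.smul_apply,
        ballOp_perfectCode hC hu, ballOp_one hcard hu, smul_eq_mul, smul_eq_mul]
      ring) hv (by
      have : g v = if v ∈ C then 1 else 0 := by simp [hg, Finset.sum_apply]
      simp only [Pi.sub_apply, Pi.smul_apply, Pi.one_apply, smul_eq_mul, this]
      split_ifs <;> omega)
  have hy : ((k : ℤ) * (k + 1) - (2 * w - 3)) ^ 2 = 2 * w ^ 2 - 6 * w + 5 := by
    linear_combination hk
  refine ⟨((k : ℤ) * (k + 1) - (2 * w - 3)).natAbs, ?_, ?_⟩ <;>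
    rw [Int.natAbs_sq, hy]
  ring
end

section
/- Let w ≥ 2 be an integer. If there exists a 2-perfect code in the Johnson graph J(2w,w), then there exists a nonnegative integer y with y² = 2w² - 6w + 5 such that at least one of the integers 8w - 11 + 4y and 8w - 11 - 4y is the square of an integer. -/
theorem card_filter_subset_powersetCard {α : Type*} [DecidableEq α] {A S : Finset α}
    (hA : A ⊆ S) (r : ℕ) :
    ((S.powersetCard r).filter (A ⊆ ·)).card =
      if A.card ≤ r then (S.card - A.card).choose (r - A.card) else 0 := by
  split_ifs with h
  · rw [← Finset.card_sdiff_of_subset hA, ← Finset.card_powersetCard]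
    refine Finset.card_nbij' (· \ A) (· ∪ A) ?_ ?_ ?_ ?_
    · intro s hs
      simp only [Finset.mem_coe, Finset.mem_filter, Finset.mem_powersetCard] at hs
      simp only [Finset.mem_coe, Finset.mem_powersetCard]
      exact ⟨Finset.sdiff_subset_sdiff hs.1.1 le_rfl,
        by rw [Finset.card_sdiff_of_subset hs.2, hs.1.2]⟩
    · intro s hs
      simp only [Finset.mem_coe, Finset.mem_powersetCard] at hs
      simp only [Finset.mem_coe, Finset.mem_filter, Finset.mem_powersetCard]
      have hd : Disjoint s A := Finset.disjoint_of_subset_left hs.1 Finset.sdiff_disjoint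
      refine ⟨⟨Finset.union_subset (hs.1.trans Finset.sdiff_subset) hA, ?_⟩,
        Finset.subset_union_right⟩
      rw [Finset.card_union_of_disjoint hd, hs.2]
      omega
    · intro s hs
      simp only [Finset.mem_coe, Finset.mem_filter, Finset.mem_powersetCard] at hs
      exact Finset.sdiff_union_of_subset hs.2
    · intro s hs
      simp only [Finset.mem_coe, Finset.mem_powersetCard] at hs
      have hd : Disjoint s A := Finset.disjoint_of_subset_left hs.1 Finset.sdiff_disjoint
      exact Finset.union_sdiff_cancel_right hd
  · rw [Finset.card_eq_zero, Finset.filter_eq_empty_iff]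
    intro s hs hAs
    exact h ((Finset.card_le_card hAs).trans_eq (Finset.mem_powersetCard.mp hs).2)

/-- The number of sets of the same size as `c` that contain `T` and are at Johnson distance
`i` from `c`. -/
theorem card_superset_at_johnsonDist {n w : ℕ} {c : Finset (Fin n)} (hc : c.card = w)
    (T : Finset (Fin n)) (i : ℕ) :
    (Finset.univ.filter fun v : Finset (Fin n) =>
      v.card = w ∧ T ⊆ v ∧ johnsonDist v c = i).card =
    (c \ T).card.choose i *
      if (T \ c).card ≤ i then (n - w - (T \ c).card).choose (i - (T \ c).card) else 0 := by
  have hcc : cᶜ.card = n - w := by rw [Finset.card_compl, Fintype.card_fin, hc]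
  have hsub : T \ c ⊆ cᶜ := fun a ha => by simp at ha ⊢; exact ha.2
  rw [← hcc, ← card_filter_subset_powersetCard hsub, ← Finset.card_powersetCard,
    ← Finset.card_product]
  have hcard (v : Finset (Fin n)) : (v \ c).card + c.card = (c \ v).card + v.card := by
    rw [Finset.card_sdiff_add_card, Finset.card_sdiff_add_card, Finset.union_comm]
  refine Finset.card_nbij' (fun v => (c \ v, v \ c)) (fun p => (c \ p.1) ∪ p.2) ?_ ?_ ?_ ?_
  · intro v hv
    rw [Finset.mem_coe, Finset.mem_filter, johnsonDist] at hv
    obtain ⟨-, hvw, hT, hi⟩ := hv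
    rw [Finset.inter_comm, ← Finset.card_sdiff] at hi
    have := hcard v
    simp only [Finset.coe_product, Set.mem_prod, Finset.mem_coe, Finset.mem_powersetCard,
      Finset.mem_filter]
    refine ⟨⟨Finset.sdiff_subset_sdiff le_rfl hT, by omega⟩, ⟨?_, hi⟩,
      Finset.sdiff_subset_sdiff hT le_rfl⟩
    intro a ha
    simp at ha ⊢
    exact ha.2
  · rintro ⟨P, Q⟩ h
    simp only [Finset.coe_product, Set.mem_prod, Finset.mem_coe, Finset.mem_powersetCard,
      Finset.mem_filter] at h
    obtain ⟨⟨hP, hPi⟩, ⟨hQ, hQi⟩, hTQ⟩ := h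
    have hQc : Disjoint Q c := Finset.subset_compl_iff_disjoint_right.mp hQ
    have hPc : P ⊆ c := hP.trans Finset.sdiff_subset
    have h1 : ((c \ P) ∪ Q) \ c = Q := by
      ext a
      have := @hQ a
      simp at this ⊢
      tauto
    have h2 : c \ ((c \ P) ∪ Q) = P := by
      ext a
      have := @hQ a
      have := @hPc a
      simp at *
      tauto
    have := hcard ((c \ P) ∪ Q)
    rw [h1, h2] at this
    rw [Finset.mem_coe, Finset.mem_filter, johnsonDist]
    dsimp only
    refine ⟨Finset.mem_univ _, by omega, ?_,
      by rw [Finset.inter_comm, ← Finset.card_sdiff, h1, hQi]⟩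
    intro a ha
    have := @hTQ a
    have := @hP a
    simp at *
    tauto
  · intro v _
    ext a
    simp
    tauto
  · rintro ⟨P, Q⟩ h
    simp only [Finset.coe_product, Set.mem_prod, Finset.mem_coe, Finset.mem_powersetCard,
      Finset.mem_filter] at h
    obtain ⟨⟨hP, -⟩, ⟨hQ, -⟩, -⟩ := h
    ext a
    · have := @hQ a
      have := @hP a
      simp at *
      tauto
    · have := @hQ a
      simp at *
      tauto

/-- The eigenvalue of the ball of radius `2` in `J(2w,w)` on the `j`-th eigenspace,
where `w = j + x`. -/
def ballEigenvalue (j x : ℕ) : ℤ :=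
  (1 + x * (j + x : ℕ) + x.choose 2 * (j + x).choose 2 : ℕ)
    - j * ((x + 1) + (x + 1).choose 2 * ((j + x : ℕ) - 1)) + j.choose 2 * (x + 2).choose 2

theorem card_superset_ball {w j x : ℕ} {c T : Finset (Fin (2 * w))} (hc : c.card = w)
    (hT : T.card = j) (hx : w = j + x) :
    ((Finset.univ.filter fun v : Finset (Fin (2 * w)) =>
      v.card = w ∧ T ⊆ v ∧ johnsonDist v c ≤ 2).card : ℤ) =
    ballEigenvalue j x * (if T ⊆ c then 1 else 0)
      + ((x + 1) + (x + 1).choose 2 * (w - 1) - (j - 1) * (x + 2).choose 2) *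
        ((T.powersetCard 1).filter fun s => T \ s ⊆ c).card
      + (x + 2).choose 2 * ((T.powersetCard 2).filter fun s => T \ s ⊆ c).card := by
  have hsplit : (Finset.univ.filter fun v : Finset (Fin (2 * w)) =>
      v.card = w ∧ T ⊆ v ∧ johnsonDist v c ≤ 2).card =
      ∑ i ∈ Finset.range 3, (Finset.univ.filter fun v : Finset (Fin (2 * w)) =>
        v.card = w ∧ T ⊆ v ∧ johnsonDist v c = i).card := by
    rw [Finset.card_eq_sum_card_fiberwise (f := fun v => johnsonDist v c)
      (t := Finset.range 3)]
    · refine Finset.sum_congr rfl fun i hi => ?_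
      rw [Finset.filter_filter]
      congr 1
      ext v
      have := Finset.mem_range.mp hi
      simp only [Finset.mem_filter, Finset.mem_univ, true_and]
      constructor
      · rintro ⟨⟨h1, h2, -⟩, h3⟩
        exact ⟨h1, h2, h3⟩
      · rintro ⟨h1, h2, h3⟩
        exact ⟨⟨h1, h2, by omega⟩, h3⟩
    · intro v hv
      simp at hv ⊢
      omega
  have hD (r : ℕ) : ((T.powersetCard r).filter fun s => T \ s ⊆ c).card =
      if (T \ c).card ≤ r then (T.card - (T \ c).card).choose (r - (T \ c).card) else 0 := by
    rw [← card_filter_subset_powersetCard Finset.sdiff_subset]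
    congr 2
    funext s
    exact propext sdiff_le_comm
  have hcard : (c \ T).card + T.card = (T \ c).card + c.card := by
    rw [Finset.card_sdiff_add_card, Finset.card_sdiff_add_card, Finset.union_comm]
  have hm0 : T ⊆ c ↔ (T \ c).card = 0 := by
    rw [Finset.card_eq_zero, Finset.sdiff_eq_empty_iff_subset]
  have hmj : (T \ c).card ≤ j := hT ▸ Finset.card_le_card Finset.sdiff_subset
  simp only [hsplit, card_superset_at_johnsonDist hc, hD, hT, hm0]
  generalize (T \ c).card = m at *
  obtain hcT : (c \ T).card = x + m := by omega
  rw [hcT, show 2 * w - w = w by omega]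
  subst hx
  rcases m with _ | _ | _ | m
  · simp [Finset.sum_range_succ, ballEigenvalue]
    have : (j.choose 2 : ℤ) * 2 = j * (j - 1) := by
      have h := Nat.cast_choose_two ℚ j
      rw [← Int.cast_inj (α := ℚ)]
      push_cast
      rw [h]
      ring
    linear_combination (-(x + 2).choose 2 : ℤ) * this
  · have : ((j + x - 1 : ℕ) : ℤ) = j + x - 1 := by omega
    have : ((j - 1 : ℕ) : ℤ) = j - 1 := by omega
    simp [Finset.sum_range_succ, *]
    ring
  · simp [Finset.sum_range_succ]
  · simp [Finset.sum_range_succ]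

theorem IsPerfectCode.sum_card_superset_ball {n w e : ℕ} {C : Finset (Finset (Fin n))}
    (hC : IsPerfectCode n w e C) (T : Finset (Fin n)) :
    ∑ c ∈ C, (Finset.univ.filter fun v : Finset (Fin n) =>
      v.card = w ∧ T ⊆ v ∧ johnsonDist v c ≤ e).card =
    ((Finset.univ.powersetCard w).filter (T ⊆ ·)).card := by
  rw [Finset.card_eq_sum_ones ((Finset.univ.powersetCard w).filter (T ⊆ ·))]
  simp only [Finset.card_filter]
  rw [Finset.sum_comm, Finset.sum_filter, Finset.powersetCard_eq_filter, Finset.sum_filter]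
  simp only [Finset.powerset_univ]
  refine Finset.sum_congr rfl fun v _ => ?_
  rw [← Finset.card_filter]
  by_cases hv : v.card = w
  · by_cases hT : T ⊆ v
    · simp only [hv, hT, true_and, if_true]
      obtain ⟨c, hc, huniq⟩ := hC.2 v hv
      rw [Finset.card_eq_one]
      refine ⟨c, ?_⟩
      ext d
      simp only [Finset.mem_filter, Finset.mem_singleton]
      exact ⟨huniq d, fun h => h ▸ hc⟩
    · simp [hT]
  · simp [hv]

theorem IsDesign.sum_card_filter_sdiff {n k lam j r : ℕ} {C : Finset (Finset (Fin n))}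
    (hC : IsDesign n k lam C) (hj : k = j - r) {T : Finset (Fin n)} (hT : T.card = j) :
    ∑ c ∈ C, ((T.powersetCard r).filter fun s => T \ s ⊆ c).card = j.choose r * lam := by
  simp only [Finset.card_filter]
  rw [Finset.sum_comm, ← hT, ← Finset.card_powersetCard, ← smul_eq_mul, ← Finset.sum_const]
  refine Finset.sum_congr rfl fun s hs => ?_
  rw [← Finset.card_filter]
  obtain ⟨hsT, hsr⟩ := Finset.mem_powersetCard.mp hs
  exact hC _ (by rw [Finset.card_sdiff_of_subset hsT, hT, hsr, hj])

theorem IsPerfectCode.exists_isDesign_of_ballEigenvalue_ne_zero {w : ℕ}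
    {C : Finset (Finset (Fin (2 * w)))} (hC : IsPerfectCode (2 * w) w 2 C)
    (h : ∀ j x : ℕ, w = j + x → ballEigenvalue j x ≠ 0) (j : ℕ) (hj : j ≤ w) :
    ∃ lam, IsDesign (2 * w) j lam C := by
  induction j using Nat.strong_induction_on with
  | _ j ih =>
    rcases Nat.eq_zero_or_pos j with rfl | hpos
    · refine ⟨C.card, fun T hT => ?_⟩
      simp [Finset.card_eq_zero.mp hT]
    obtain ⟨x, hx⟩ := Nat.exists_eq_add_of_le hj
    obtain ⟨l₁, h₁⟩ := ih (j - 1) (by omega) (by omega)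
    obtain ⟨l₂, h₂⟩ := ih (j - 2) (by omega) (by omega)
    have key (T : Finset (Fin (2 * w))) (hT : T.card = j) :
        ballEigenvalue j x * ((C.filter fun c => T ⊆ c).card : ℤ) =
          (2 * w - j).choose (w - j)
          - ((x + 1) + (x + 1).choose 2 * (w - 1) - (j - 1) * (x + 2).choose 2) *
            (j.choose 1 * l₁ : ℕ)
          - (x + 2).choose 2 * (j.choose 2 * l₂ : ℕ) := by
      have hsum := hC.sum_card_superset_ball T
      rw [card_filter_subset_powersetCard (Finset.subset_univ T), hT, if_pos hj,
        Finset.card_univ, Fintype.card_fin] at hsum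
      rw [← hsum, ← h₁.sum_card_filter_sdiff rfl hT, ← h₂.sum_card_filter_sdiff rfl hT,
        Finset.card_filter]
      push_cast only [Nat.cast_sum]
      rw [Finset.sum_congr rfl fun c hc => card_superset_ball (hC.1 c hc) hT hx]
      simp only [Finset.sum_add_distrib, ← Finset.mul_sum]
      push_cast
      ring
    by_cases hex : ∃ T : Finset (Fin (2 * w)), T.card = j
    · obtain ⟨T₀, hT₀⟩ := hex
      refine ⟨(C.filter fun c => T₀ ⊆ c).card, fun T hT => ?_⟩
      have := mul_left_cancel₀ (h j x hx) ((key T hT).trans (key T₀ hT₀).symm)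
      exact_mod_cast this
    · exact ⟨0, fun T hT => absurd ⟨T, hT⟩ hex⟩

theorem IsPerfectCode.exists_ballEigenvalue_eq_zero {w : ℕ} (hw : 1 ≤ w)
    {C : Finset (Finset (Fin (2 * w)))} (hC : IsPerfectCode (2 * w) w 2 C) :
    ∃ j x : ℕ, w = j + x ∧ ballEigenvalue j x = 0 := by
  by_contra! h
  obtain ⟨lam, hlam⟩ := hC.exists_isDesign_of_ballEigenvalue_ne_zero h w le_rfl
  obtain ⟨v, -, hv⟩ := Finset.exists_subset_card_eq
    (show w ≤ (Finset.univ : Finset (Fin (2 * w))).card by simp; omega)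
  obtain ⟨c, ⟨hc, -⟩, -⟩ := hC.2 v hv
  have hcw := hC.1 c hc
  have hpos : 0 < lam := by
    rw [← hlam c hcw]
    exact Finset.card_pos.mpr ⟨c, by simp [hc]⟩
  have hall (d : Finset (Fin (2 * w))) (hd : d.card = w) : d ∈ C := by
    rw [← hlam d hd] at hpos
    obtain ⟨d', hd'⟩ := Finset.card_pos.mp hpos
    obtain ⟨hd'C, hsub⟩ := Finset.mem_filter.mp hd'
    rwa [Finset.eq_of_subset_of_card_le hsub (by rw [hd, hC.1 d' hd'C])]
  obtain ⟨p, hp⟩ := Finset.card_pos.mp (show 0 < c.card by omega)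
  obtain ⟨q, hq⟩ := Finset.card_pos.mp
    (show 0 < cᶜ.card by rw [Finset.card_compl, Fintype.card_fin]; omega)
  rw [Finset.mem_compl] at hq
  set d := insert q (c.erase p) with hd
  have hdw : d.card = w := by
    rw [hd, Finset.card_insert_of_notMem (by simp [hq]), Finset.card_erase_of_mem hp]
    omega
  have hdist : johnsonDist d c ≤ 2 := by
    rw [johnsonDist, Finset.inter_comm, ← Finset.card_sdiff]
    have : d \ c ⊆ {q} := by
      intro a
      simp [hd]
      tauto
    exact (Finset.card_le_card this).trans (by simp)
  obtain ⟨_, -, huniq⟩ := hC.2 d hdw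
  have hcd : c = d :=
    (huniq c ⟨hc, hdist⟩).trans (huniq d ⟨hall d hdw, by simp [johnsonDist]⟩).symm
  exact hq (hcd ▸ Finset.mem_insert_self q _)

theorem four_mul_ballEigenvalue (j x : ℕ) :
    4 * ballEigenvalue j x = (x ^ 2 + x - (2 * (j + x : ℕ) - 3)) ^ 2 -
      (2 * (j + x : ℕ) ^ 2 - 6 * (j + x : ℕ) + 5) := by
  have h (a : ℕ) : (a.choose 2 : ℚ) = a * (a - 1) / 2 := Nat.cast_choose_two ℚ a
  rw [← Int.cast_inj (α := ℚ)]
  simp only [ballEigenvalue]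
  push_cast [h]
  ring

/-- If a `2`-perfect code exists in `J(2w,w)`, then there is a nonnegative
integer `y` with `y² = 2w² - 6w + 5` such that `8w - 11 + 4y` or `8w - 11 - 4y`
is the square of an integer. -/
theorem two_perfect_square_condition (w : ℕ) (hw : 2 ≤ w)
    (hC : ∃ C : Finset (Finset (Fin (2 * w))), IsPerfectCode (2 * w) w 2 C) :
    ∃ y : ℕ, (y : ℤ) ^ 2 = 2 * (w : ℤ) ^ 2 - 6 * (w : ℤ) + 5 ∧
      ((∃ α : ℤ, α ^ 2 = 8 * (w : ℤ) - 11 + 4 * (y : ℤ)) ∨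
       (∃ β : ℤ, β ^ 2 = 8 * (w : ℤ) - 11 - 4 * (y : ℤ))) := by
  obtain ⟨C, hC⟩ := hC
  obtain ⟨j, x, hx, h0⟩ := hC.exists_ballEigenvalue_eq_zero (by omega)
  have key := four_mul_ballEigenvalue j x
  rw [h0, ← hx] at key
  set z : ℤ := x ^ 2 + x - (2 * w - 3) with hz
  refine ⟨z.natAbs, ?_, ?_⟩
  · rw [Int.natAbs_sq]
    linarith
  · rcases abs_choice z with h | h
    · left
      refine ⟨2 * x + 1, ?_⟩
      rw [Int.natCast_natAbs, h, hz]
      ring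
    · right
      refine ⟨2 * x + 1, ?_⟩
      rw [Int.natCast_natAbs, h, hz]
      ring
end

section
/- Let w ≥ 2 be an integer. If there exists a 2-perfect code in the Johnson graph J(2w,w), then there exists a nonnegative integer m such that 4w = (1+√2)^{2m+1} + (1-√2)^{2m+1} + 6 (as real numbers) and at least one of the two real numbers √2·((1+√2)^{2m} - (1-√2)^{2m}) + 1 and √2·((1+√2)^{2m+2} - (1-√2)^{2m+2}) + 1 is the square of an integer. -/
namespace JohnsonPerfect

open Finset

variable {α : Type*} [Fintype α] [DecidableEq α]

set_option linter.unusedSectionVars false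

/-- The lowering operator of the Boolean lattice: sum over all one-point extensions. -/
def lower (f : Finset α → ℝ) (T : Finset α) : ℝ := ∑ x ∈ Tᶜ, f (insert x T)

/-- The raising operator of the Boolean lattice: sum over all one-point deletions. -/
def raise (f : Finset α → ℝ) (S : Finset α) : ℝ := ∑ x ∈ S, f (S.erase x)

/-- `f` vanishes away from the `k`-subsets. -/
def SupportedAt (k : ℕ) (f : Finset α → ℝ) : Prop := ∀ S : Finset α, S.card ≠ k → f S = 0

theorem SupportedAt.lower {k : ℕ} {f : Finset α → ℝ} (hf : SupportedAt (k + 1) f) :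
    SupportedAt k (lower f) := by
  intro T hT
  refine sum_eq_zero fun x hx => hf _ ?_
  rw [card_insert_of_notMem (by simpa using hx)]
  omega

theorem SupportedAt.raise {k : ℕ} {f : Finset α → ℝ} (hf : SupportedAt k f) :
    SupportedAt (k + 1) (raise f) := by
  intro S hS
  refine sum_eq_zero fun x hx => hf _ ?_
  rw [card_erase_of_mem hx]
  have := card_pos.2 ⟨x, hx⟩
  omega

theorem SupportedAt.lower_eq_zero {f : Finset α → ℝ} (hf : SupportedAt 0 f) :
    JohnsonPerfect.lower f = 0 := by
  funext T
  refine sum_eq_zero fun x hx => hf _ ?_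
  rw [card_insert_of_notMem (by simpa using hx)]
  omega

theorem lower_raise (f : Finset α → ℝ) (S : Finset α) :
    lower (raise f) S = raise (lower f) S + (Fintype.card α - 2 * S.card : ℝ) * f S := by
  have h1 : lower (raise f) S =
      ∑ x ∈ Sᶜ, (f S + ∑ y ∈ S, f (insert x (S.erase y))) := by
    refine sum_congr rfl fun x hx => ?_
    have hx' : x ∉ S := by simpa using hx
    rw [raise, sum_insert hx', erase_insert hx']
    congr 1
    refine sum_congr rfl fun y hy => ?_
    rw [erase_insert_of_ne (by rintro rfl; exact hx' hy)]
  have h2 : raise (lower f) S =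
      ∑ y ∈ S, (f S + ∑ x ∈ Sᶜ, f (insert x (S.erase y))) := by
    refine sum_congr rfl fun y hy => ?_
    rw [lower, compl_erase, sum_insert (by simpa using hy), insert_erase hy]
  have hc : ((Sᶜ).card : ℝ) = Fintype.card α - S.card := by
    rw [card_compl, Nat.cast_sub (card_le_univ S)]
  rw [h1, h2, sum_add_distrib, sum_add_distrib, sum_comm]
  simp only [sum_const, nsmul_eq_mul, hc]
  ring

theorem raise_smul_apply (a : ℝ) (f : Finset α → ℝ) (S : Finset α) :
    raise (fun T => a * f T) S = a * raise f S := by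
  simp [raise, mul_sum]

theorem lower_smul_apply (a : ℝ) (f : Finset α → ℝ) (S : Finset α) :
    lower (fun T => a * f T) S = a * lower f S := by
  simp [lower, mul_sum]

/-- Raising after lowering, as a linear map. -/
def raiseLower : (Finset α → ℝ) →ₗ[ℝ] (Finset α → ℝ) where
  toFun f := raise (lower f)
  map_add' f g := by
    funext S
    simp [raise, lower, sum_add_distrib]
  map_smul' a f := by
    funext S
    simp [raise, lower, mul_sum]

theorem raiseLower_apply (f : Finset α → ℝ) : raiseLower f = raise (lower f) := rfl

theorem SupportedAt.raiseLower {k : ℕ} {f : Finset α → ℝ} (hf : SupportedAt k f) :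
    SupportedAt k (raiseLower f) := by
  cases k with
  | zero =>
    intro S _
    rw [raiseLower_apply, hf.lower_eq_zero]
    simp [JohnsonPerfect.raise]
  | succ k => exact hf.lower.raise

/-- The eigenvalues of `raiseLower` on functions supported on `k`-subsets. -/
theorem eigenvalue_eq {k : ℕ} {f : Finset α → ℝ} (hf : SupportedAt k f) (hne : f ≠ 0) {μ : ℝ}
    (h : raiseLower f = μ • f) :
    ∃ t ≤ k, μ = (k - t : ℝ) * (Fintype.card α - k - t + 1) := by
  induction k generalizing f μ with
  | zero =>
    rw [raiseLower_apply, hf.lower_eq_zero] at h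
    have h0 : raise (0 : Finset α → ℝ) = 0 := by funext S; simp [raise]
    rw [h0, eq_comm, smul_eq_zero] at h
    exact ⟨0, le_rfl, by simpa [hne] using h⟩
  | succ k ih =>
    by_cases hl : lower f = 0
    · rw [raiseLower_apply, hl] at h
      have h0 : raise (0 : Finset α → ℝ) = 0 := by funext S; simp [raise]
      rw [h0, eq_comm, smul_eq_zero] at h
      refine ⟨k + 1, le_rfl, ?_⟩
      simpa [hne] using h
    · have key : raiseLower (lower f) = (μ - (Fintype.card α - 2 * k)) • lower f := by
        funext S
        have h1 := lower_raise (lower f) S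
        rw [raiseLower_apply] at h ⊢
        rw [h] at h1
        have h2 : lower (μ • f) S = μ * lower f S := lower_smul_apply μ f S
        rw [h2] at h1
        by_cases hS : S.card = k
        · rw [hS] at h1
          simp only [Pi.smul_apply, smul_eq_mul]
          linarith
        · have h3 := hf.lower S hS
          rw [h3] at h1
          simp only [Pi.smul_apply, smul_eq_mul, h3]
          linarith
      obtain ⟨t, ht, e⟩ := ih hf.lower hl key
      refine ⟨t, by omega, ?_⟩
      push_cast
      linear_combination e

/-- The sum of `f` over all supersets. -/
def upSum (f : Finset α → ℝ) (T : Finset α) : ℝ := ∑ c, if T ⊆ c then f c else 0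

theorem lower_upSum {k : ℕ} {f : Finset α → ℝ} (hf : SupportedAt k f) (T : Finset α) :
    lower (upSum f) T = (k - T.card : ℝ) * upSum f T := by
  unfold lower upSum
  rw [sum_comm, mul_sum]
  refine sum_congr rfl fun c _ => ?_
  by_cases hc : c.card = k
  · by_cases hT : T ⊆ c
    · have : ∀ x ∈ Tᶜ, (if insert x T ⊆ c then f c else 0) = if x ∈ c then f c else 0 := by
        intro x _
        simp [insert_subset_iff, hT]
      rw [sum_congr rfl this, ← sum_filter, sum_const, nsmul_eq_mul, if_pos hT]
      have e : Tᶜ.filter (· ∈ c) = c \ T := by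
        ext x
        simp [and_comm]
      rw [e, card_sdiff_of_subset hT, Nat.cast_sub (card_le_card hT), hc]
    · rw [if_neg hT, mul_zero]
      exact sum_eq_zero fun x _ => if_neg fun h => hT ((subset_insert _ _).trans h)
  · simp [hf c hc]

theorem upSum_eq_self {k : ℕ} {f : Finset α → ℝ} (hf : SupportedAt k f) {T : Finset α}
    (hT : T.card = k) : upSum f T = f T := by
  unfold upSum
  rw [sum_eq_single T]
  · simp
  · intro c _ hc
    split_ifs with h
    · refine hf c fun h' => hc (eq_of_subset_of_card_le h (by omega)).symm
    · rfl
  · simp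

theorem lower_eq_upSum {k : ℕ} {f : Finset α → ℝ} (hf : SupportedAt (k + 1) f) {T : Finset α}
    (hT : T.card = k) : lower f T = upSum f T := by
  have h := lower_upSum hf T
  rw [hT] at h
  push_cast at h
  rw [add_sub_cancel_left, one_mul] at h
  rw [← h]
  refine sum_congr rfl fun x hx => (upSum_eq_self hf ?_).symm
  rw [card_insert_of_notMem (by simpa using hx), hT]

theorem lower_lower_eq_upSum {k : ℕ} {f : Finset α → ℝ} (hf : SupportedAt (k + 2) f)
    {T : Finset α} (hT : T.card = k) : lower (lower f) T = 2 * upSum f T := by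
  have h := lower_upSum hf T
  rw [hT] at h
  push_cast at h
  rw [add_sub_cancel_left] at h
  rw [← h]
  refine sum_congr rfl fun x hx => lower_eq_upSum (k := k + 1) hf ?_
  rw [card_insert_of_notMem (by simpa using hx), hT]

theorem raise_sum_apply (F : Finset α → Finset α → ℝ) (S : Finset α) :
    raise (fun T => ∑ c, F c T) S = ∑ c, raise (F c) S :=
  sum_comm

/-- The action of `raise` on functions of `|S ∩ c|` and `|S \ c|`. -/
theorem raise_of_card (c : Finset α) (F : ℕ → ℕ → ℝ) (S : Finset α) :
    raise (fun T => F (T ∩ c).card (T \ c).card) S =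
      (S ∩ c).card * F ((S ∩ c).card - 1) (S \ c).card +
        (S \ c).card * F (S ∩ c).card ((S \ c).card - 1) := by
  unfold raise
  have h := sum_inter_add_sum_sdiff S c
    (fun x => F (S.erase x ∩ c).card (S.erase x \ c).card)
  rw [← h]
  congr 1
  · rw [← nsmul_eq_mul]
    refine sum_eq_card_nsmul fun x hx => ?_
    have hx' := mem_inter.1 hx
    have e1 : S.erase x ∩ c = (S ∩ c).erase x := by rw [erase_inter]
    have e2 : S.erase x \ c = S \ c := by
      ext y
      simp only [mem_sdiff, mem_erase]
      refine ⟨fun h => ⟨h.1.2, h.2⟩, fun h => ⟨⟨?_, h.1⟩, h.2⟩⟩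
      rintro rfl
      exact h.2 hx'.2
    rw [e1, e2, card_erase_of_mem hx]
  · rw [← nsmul_eq_mul]
    refine sum_eq_card_nsmul fun x hx => ?_
    have hx' := mem_sdiff.1 hx
    have e1 : S.erase x ∩ c = S ∩ c := by
      rw [erase_inter, erase_eq_of_notMem]
      exact fun h => hx'.2 (mem_inter.1 h).2
    have e2 : S.erase x \ c = (S \ c).erase x := by
      ext y
      simp only [mem_sdiff, mem_erase]
      tauto
    rw [e1, e2, card_erase_of_mem hx]

theorem subset_ind_eq (c T : Finset α) (a : ℝ) :
    (if T ⊆ c then a else 0) = if (T \ c).card = 0 then a else 0 := by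
  simp [sdiff_eq_empty_iff_subset]

theorem raise_ind (c : Finset α) (a : ℝ) :
    raise (fun T => if T ⊆ c then a else 0) =
      fun S => if (S \ c).card = 0 then (S ∩ c).card * a
        else if (S \ c).card = 1 then a else 0 := by
  funext S
  simp only [subset_ind_eq]
  rw [raise_of_card c (fun _ i => if i = 0 then a else 0) S]
  rcases (S \ c).card with _ | _ | i <;> simp

theorem raise_raise_ind (c : Finset α) (a : ℝ) (S : Finset α) :
    raise (raise (fun T => if T ⊆ c then a else 0)) S =
      if (S \ c).card = 0 then (S ∩ c).card * ((S ∩ c).card - 1 : ℝ) * a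
        else if (S \ c).card = 1 then 2 * (S ∩ c).card * a
        else if (S \ c).card = 2 then 2 * a else 0 := by
  rw [raise_ind, raise_of_card c
    (fun j i => if i = 0 then j * a else if i = 1 then a else 0) S]
  rcases (S \ c).card with _ | _ | _ | i
  · rcases (S ∩ c).card with _ | j
    · simp
    · simp
      ring
  · simp
    ring
  · simp
  · simp

/-- The ball sum of radius two as a polynomial in `raiseLower`. -/
theorem ball_sum_eq {w : ℕ} (hw : 2 ≤ w) (hα : Fintype.card α = 2 * w) {f : Finset α → ℝ}
    (hf : SupportedAt w f) {S : Finset α} (hS : S.card = w) :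
    4 * ∑ c, (if (S \ c).card ≤ 2 then f c else 0) =
      raiseLower (raiseLower f) S + (6 - 4 * w) * raiseLower f S +
        (4 + 2 * w ^ 2 - 6 * w) * f S := by
  obtain ⟨k, rfl⟩ : ∃ k, w = k + 2 := ⟨w - 2, by omega⟩
  have h1 : raiseLower f S = ∑ c, raise (fun T => if T ⊆ c then f c else 0) S := by
    rw [← raise_sum_apply]
    refine sum_congr rfl fun x hx => lower_eq_upSum (k := k + 1) hf ?_
    rw [card_erase_of_mem hx, hS]
    omega
  have h2 : raise (raise (lower (lower f))) S =
      2 * ∑ c, raise (raise (fun T => if T ⊆ c then f c else 0)) S := by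
    rw [← raise_sum_apply, ← raise_smul_apply]
    refine sum_congr rfl fun x hx => ?_
    dsimp only
    rw [← raise_sum_apply, ← raise_smul_apply]
    refine sum_congr rfl fun y hy => lower_lower_eq_upSum (k := k) hf ?_
    rw [card_erase_of_mem hy, card_erase_of_mem hx, hS]
    omega
  have h3 : raise (raise (lower (lower f))) S =
      raiseLower (raiseLower f) S - 2 * raiseLower f S := by
    have : ∀ x ∈ S, raise (lower (lower f)) (S.erase x) =
        lower (raise (lower f)) (S.erase x) - 2 * lower f (S.erase x) := by
      intro x hx
      rw [lower_raise, hα, card_erase_of_mem hx, hS]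
      push_cast [show k + 2 - 1 = k + 1 from rfl]
      ring
    rw [raise, sum_congr rfl this, sum_sub_distrib, ← mul_sum]
    rfl
  have h4 : f S = ∑ c, if (S \ c).card = 0 then f c else 0 := by
    rw [← upSum_eq_self hf hS]
    exact sum_congr rfl fun c _ => subset_ind_eq c S (f c)
  have h5 : raiseLower (raiseLower f) S =
      2 * ∑ c, raise (raise (fun T => if T ⊆ c then f c else 0)) S + 2 * raiseLower f S := by
    linarith
  rw [h5, h1, h4]
  simp only [mul_sum, ← sum_add_distrib]
  refine sum_congr rfl fun c _ => ?_
  rw [raise_raise_ind, raise_ind]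
  have hcard : (S ∩ c).card + (S \ c).card = k + 2 := by rw [card_inter_add_card_sdiff, hS]
  have hcard' : ((S ∩ c).card : ℝ) = k + 2 - (S \ c).card := by
    rw [eq_sub_iff_add_eq]
    exact_mod_cast hcard
  simp only [hcard']
  rcases (S \ c).card with _ | _ | _ | i
  · simp
    ring
  · simp
    ring
  · simp
    ring
  · simp

theorem SupportedAt.sub_smul {k : ℕ} {f g : Finset α → ℝ} (hf : SupportedAt k f)
    (hg : SupportedAt k g) (a : ℝ) : SupportedAt k (f - a • g) := by
  intro S hS
  simp [hf S hS, hg S hS]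

/-- A function annihilated by a split quadratic in `raiseLower` yields an eigenvalue root. -/
theorem exists_root {w : ℕ} (hα : Fintype.card α = 2 * w) {g : Finset α → ℝ}
    (hg : SupportedAt w g) (hne : g ≠ 0) (a b : ℝ)
    (h : raiseLower (raiseLower g) - (a + b) • raiseLower g + (a * b) • g = 0) :
    ∃ s : ℕ, ((s : ℝ) * (s + 1) = a ∨ (s : ℝ) * (s + 1) = b) := by
  have fin : ∀ (μ : ℝ) (v : Finset α → ℝ), SupportedAt w v → v ≠ 0 → raiseLower v = μ • v →
      ∃ s : ℕ, (s : ℝ) * (s + 1) = μ := by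
    intro μ v hv hv0 hμ
    obtain ⟨t, ht, e⟩ := eigenvalue_eq hv hv0 hμ
    refine ⟨w - t, ?_⟩
    rw [e, hα, Nat.cast_sub ht]
    push_cast
    ring
  by_cases hb : raiseLower g - b • g = 0
  · obtain ⟨s, hs⟩ := fin b g hg hne (sub_eq_zero.1 hb)
    exact ⟨s, Or.inr hs⟩
  · obtain ⟨s, hs⟩ := fin a _ (hg.raiseLower.sub_smul hg b) hb (by
      rw [← sub_eq_zero, ← h, map_sub, map_smul]
      module)
    exact ⟨s, Or.inl hs⟩

/-- The all-one function on `w`-subsets is an eigenfunction. -/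
theorem raiseLower_one {w : ℕ} (hα : Fintype.card α = 2 * w) {S : Finset α} (hS : S.card = w) :
    raiseLower (fun T : Finset α => if T.card = w then (1 : ℝ) else 0) S = w * (w + 1) := by
  rw [raiseLower_apply, raise, ← hS, ← nsmul_eq_mul]
  refine sum_eq_card_nsmul fun x hx => ?_
  have hpos := card_pos.2 ⟨x, hx⟩
  have hc : (S.erase x).card = S.card - 1 := card_erase_of_mem hx
  rw [lower, sum_congr rfl (g := fun _ => (1 : ℝ))]
  · rw [sum_const, nsmul_eq_mul, mul_one, card_compl, hα, hc]
    have : 2 * w - (S.card - 1) = S.card + 1 := by omega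
    rw [this]
    push_cast
    rfl
  · intro y hy
    rw [if_pos]
    rw [card_insert_of_notMem (mem_compl.1 hy), hc]
    omega

/-- Lloyd-type condition for `2`-perfect codes in `J(2w, w)`. -/
theorem lloyd {w : ℕ} (hw : 2 ≤ w) {C : Finset (Finset (Fin (2 * w)))}
    (hC : IsPerfectCode (2 * w) w 2 C) :
    ∃ s : ℕ, ((s : ℝ) * (s + 1)) ^ 2 + (6 - 4 * w) * (s * (s + 1)) +
      (4 + 2 * w ^ 2 - 6 * w) = 0 := by
  have hα : Fintype.card (Fin (2 * w)) = 2 * w := Fintype.card_fin _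
  obtain ⟨hcard, huniq⟩ := hC
  set f : Finset (Fin (2 * w)) → ℝ := fun S => if S ∈ C then 1 else 0 with hfdef
  set e : Finset (Fin (2 * w)) → ℝ := fun S => if S.card = w then 1 else 0 with hedef
  have hf : SupportedAt w f := fun S hS => if_neg fun h => hS (hcard S h)
  have he : SupportedAt w e := fun S hS => if_neg hS
  have hball : ∀ S : Finset (Fin (2 * w)), S.card = w →
      ∑ c, (if (S \ c).card ≤ 2 then f c else 0) = 1 := by
    intro S hS
    obtain ⟨c, ⟨hc, hd⟩, hu⟩ := huniq S hS
    have hdist : ∀ c, johnsonDist S c = (S \ c).card := by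
      intro c
      have := card_inter_add_card_sdiff S c
      unfold johnsonDist
      omega
    rw [sum_eq_single c]
    · rw [if_pos (by rw [← hdist]; exact hd), hfdef]
      simp [hc]
    · intro b _ hb
      split_ifs with h
      · refine if_neg fun hbC => hb (hu b ⟨hbC, ?_⟩)
        rw [hdist]
        exact h
      · rfl
    · simp
  have hpoly : raiseLower (raiseLower f) + (6 - 4 * w : ℝ) • raiseLower f +
      (4 + 2 * w ^ 2 - 6 * w : ℝ) • f = (4 : ℝ) • e := by
    funext S
    simp only [Pi.add_apply, Pi.smul_apply, smul_eq_mul]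
    by_cases hS : S.card = w
    · rw [← ball_sum_eq hw hα hf hS, hball S hS, hedef]
      simp [hS]
    · rw [hf S hS, he S hS, hf.raiseLower S hS, hf.raiseLower.raiseLower S hS]
      simp
  have heig : raiseLower e = (w * (w + 1) : ℝ) • e := by
    funext S
    by_cases hS : S.card = w
    · rw [hedef, raiseLower_one hα hS]
      simp [hS]
    · simp [he.raiseLower S hS, he S hS]
  set g := raiseLower f - (w * (w + 1) : ℝ) • f with hgdef
  have hg : SupportedAt w g := hf.raiseLower.sub_smul hf _
  have hdisc : (0 : ℝ) ≤ 2 * w ^ 2 - 6 * w + 5 := by nlinarith [sq_nonneg (2 * (w : ℝ) - 3)]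
  have hsq := Real.sq_sqrt hdisc
  set r := Real.sqrt (2 * (w : ℝ) ^ 2 - 6 * w + 5)
  by_cases hg0 : g = 0
  · exfalso
    have hBf : raiseLower f = (w * (w + 1) : ℝ) • f := sub_eq_zero.1 hg0
    have hall : ∀ S : Finset (Fin (2 * w)), S.card = w → S ∈ C := by
      intro S hS
      by_contra hSC
      have h := congrFun hpoly S
      rw [hBf, map_smul, hBf] at h
      simp [hfdef, hedef, hS, hSC] at h
    obtain ⟨S, -, hS⟩ := exists_subset_card_eq
      (s := (univ : Finset (Fin (2 * w)))) (n := w) (by simp; omega)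
    obtain ⟨x, hx⟩ := card_pos.1 (show 0 < S.card by omega)
    obtain ⟨y, hy⟩ := card_pos.1 (show 0 < Sᶜ.card by rw [card_compl, hα]; omega)
    have hy' : y ∉ S := by simpa using hy
    have hT : (insert y (S.erase x)).card = w := by
      rw [card_insert_of_notMem (fun h => hy' (mem_of_mem_erase h)), card_erase_of_mem hx]
      omega
    have hne : insert y (S.erase x) ≠ S := fun h => hy' (h ▸ mem_insert_self _ _)
    refine hne ((huniq S hS).unique ⟨hall _ hT, ?_⟩ ⟨hall S hS, by simp [johnsonDist]⟩)
    have hsub : S.erase x ⊆ S ∩ insert y (S.erase x) :=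
      subset_inter (erase_subset _ _) (subset_insert _ _)
    have h1 := card_le_card hsub
    rw [card_erase_of_mem hx] at h1
    unfold johnsonDist
    omega
  · obtain ⟨s, hs⟩ := exists_root hα hg hg0 (2 * w - 3 + r) (2 * w - 3 - r) (by
      have h := congrArg (fun v => raiseLower v - (w * (w + 1) : ℝ) • v) hpoly
      simp only [map_add, map_smul, heig] at h
      have hprod : (2 * w - 3 + r) * (2 * w - 3 - r) = (4 + 2 * w ^ 2 - 6 * w : ℝ) := by
        linear_combination -hsq
      have hsum : (2 * w - 3 + r) + (2 * w - 3 - r) = (4 * w - 6 : ℝ) := by ring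
      rw [hprod, hsum, hgdef]
      simp only [map_sub, map_smul]
      have h0 : (4 : ℝ) • (w * (w + 1) : ℝ) • e - (w * (w + 1) : ℝ) • (4 : ℝ) • e = 0 := by
        module
      rw [h0] at h
      rw [← h]
      module)
    refine ⟨s, ?_⟩
    rcases hs with hs | hs <;> rw [hs] <;> linear_combination hsq

/-- Solutions of the Pell equation `y² = 2x² + 1` are powers of `(1 + √2)²`. -/
theorem pell_two (x y : ℕ) (h : y ^ 2 = 2 * x ^ 2 + 1) :
    ∃ k : ℕ, (1 + Real.sqrt 2) ^ (2 * k) = y + x * Real.sqrt 2 ∧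
      (1 - Real.sqrt 2) ^ (2 * k) = y - x * Real.sqrt 2 := by
  induction x using Nat.strong_induction_on generalizing y with
  | _ x ih =>
    rcases Nat.eq_zero_or_pos x with rfl | hx
    · have hy : y = 1 := by nlinarith
      exact ⟨0, by simp [hy]⟩
    · have h1 : 2 * y ≤ 3 * x := by nlinarith
      have h2 : 4 * x ≤ 3 * y := by nlinarith
      have h3 : x < y := by nlinarith
      obtain ⟨u, hu⟩ := Nat.exists_eq_add_of_le h1
      obtain ⟨v, hv⟩ := Nat.exists_eq_add_of_le h2
      have hxe : x = 3 * u + 2 * v := by omega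
      have hye : y = 4 * u + 3 * v := by omega
      obtain ⟨k, hk1, hk2⟩ := ih u (by omega) v (by
        rw [hxe, hye] at h
        nlinarith)
      have hs : Real.sqrt 2 ^ 2 = 2 := Real.sq_sqrt (by norm_num)
      refine ⟨k + 1, ?_, ?_⟩
      · rw [mul_add, pow_add, hk1, hxe, hye]
        push_cast
        linear_combination (v + u * Real.sqrt 2 + 2 * u) * hs
      · rw [mul_add, pow_add, hk2, hxe, hye]
        push_cast
        linear_combination (v - u * Real.sqrt 2 + 2 * u) * hs

end JohnsonPerfect

/-- If a `2`-perfect code exists in `J(2w,w)`, then for some `m ≥ 0` we have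
`4w = (1+√2)^{2m+1} + (1-√2)^{2m+1} + 6` and at least one of
`√2·((1+√2)^{2m} - (1-√2)^{2m}) + 1` and `√2·((1+√2)^{2m+2} - (1-√2)^{2m+2}) + 1`
is the square of an integer. -/
theorem two_perfect_pell_form (w : ℕ) (hw : 2 ≤ w)
    (hC : ∃ C : Finset (Finset (Fin (2 * w))), IsPerfectCode (2 * w) w 2 C) :
    ∃ m : ℕ,
      4 * (w : ℝ) = (1 + Real.sqrt 2) ^ (2 * m + 1) + (1 - Real.sqrt 2) ^ (2 * m + 1) + 6 ∧
      ((∃ k : ℤ, (k : ℝ) ^ 2 =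
          Real.sqrt 2 * ((1 + Real.sqrt 2) ^ (2 * m) - (1 - Real.sqrt 2) ^ (2 * m)) + 1) ∨
       (∃ k : ℤ, (k : ℝ) ^ 2 =
          Real.sqrt 2 * ((1 + Real.sqrt 2) ^ (2 * m + 2) - (1 - Real.sqrt 2) ^ (2 * m + 2)) + 1)) := by
  obtain ⟨C, hC⟩ := hC
  obtain ⟨s, h⟩ := JohnsonPerfect.lloyd hw hC
  obtain ⟨x, hx⟩ : ∃ x : ℕ, x = s * (s + 1) := ⟨_, rfl⟩
  have hxr : (x : ℝ) = s * (s + 1) := by rw [hx]; push_cast; ring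
  have hz : (2 * w - 3 - 2 * x : ℤ) ^ 2 = 2 * x ^ 2 + 1 := by
    rw [← hxr] at h
    have : (2 * w - 3 - 2 * x : ℝ) ^ 2 = 2 * x ^ 2 + 1 := by linear_combination 2 * h
    exact_mod_cast this
  obtain ⟨y, hy⟩ : ∃ y : ℕ, y = (2 * w - 3 - 2 * x : ℤ).natAbs := ⟨_, rfl⟩
  have hpell : y ^ 2 = 2 * x ^ 2 + 1 := by
    have : (y : ℤ) ^ 2 = 2 * x ^ 2 + 1 := by rw [hy, Int.natAbs_sq, hz]
    exact_mod_cast this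
  obtain ⟨k, hk1, hk2⟩ := JohnsonPerfect.pell_two x y hpell
  have hs : Real.sqrt 2 ^ 2 = 2 := Real.sq_sqrt (by norm_num)
  have hsquare : ((2 * s + 1 : ℤ) : ℝ) ^ 2 = 4 * x + 1 := by
    rw [hxr]
    push_cast
    ring
  rcases (by omega : (2 * w : ℤ) = 3 + 2 * x + y ∨ (2 * w : ℤ) = 3 + 2 * x - y) with hw' | hw'
  · have hwr : (2 * w : ℝ) = 3 + 2 * x + y := by exact_mod_cast hw'
    refine ⟨k, ?_, Or.inl ⟨2 * s + 1, ?_⟩⟩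
    · rw [pow_succ, pow_succ, hk1, hk2]
      linear_combination 2 * hwr - 2 * x * hs
    · rw [hsquare, hk1, hk2]
      linear_combination -2 * x * hs
  · have hwr : (2 * w : ℝ) = 3 + 2 * x - y := by exact_mod_cast hw'
    cases k with
    | zero =>
      exfalso
      rw [mul_zero, pow_zero] at hk1 hk2
      have hy1 : (y : ℝ) = 1 := by linarith
      have hy2 : y = 1 := by exact_mod_cast hy1
      have hx2 : x = 0 := by
        rw [hy2] at hpell
        nlinarith
      omega
    | succ m =>
      rw [mul_add, mul_one] at hk1 hk2
      refine ⟨m, ?_, Or.inr ⟨2 * s + 1, ?_⟩⟩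
      · have e1 : (1 + Real.sqrt 2) ^ (2 * m + 1) = (y + x * Real.sqrt 2) * (Real.sqrt 2 - 1) := by
          rw [← hk1, pow_succ _ (2 * m + 1)]
          linear_combination -(1 + Real.sqrt 2) ^ (2 * m + 1) * hs
        have e2 : (1 - Real.sqrt 2) ^ (2 * m + 1) =
            (y - x * Real.sqrt 2) * (-Real.sqrt 2 - 1) := by
          rw [← hk2, pow_succ _ (2 * m + 1)]
          linear_combination -(1 - Real.sqrt 2) ^ (2 * m + 1) * hs
        rw [e1, e2]
        linear_combination 2 * hwr - 2 * x * hs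
      · rw [hsquare, hk1, hk2]
        linear_combination -2 * x * hs
end
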